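/- The density π is infinitely differentiable on ℝ, and for every n ∈ ℕ there exists a constant C_n > 0 such that |π^{(n)}(y)| ≤ C_n (1 + |φ̄₁'(y)|)^n exp(−φ̄₁(y)) for all y ∈ ℝ, where φ̄₁(y) = Σ_{j=1}^{J₁} α_j y^{2j}. -/

import Mathlib

open MeasureTheory Real Finset

lemma aux_poly_iter (i : ℕ) : ∀ R : Polynomial ℝ,
    iteratedDeriv i (fun y => R.eval y) = fun y => (Polynomial.derivative^[i] R).eval y := by
  induction i with
  | zero => intro R; simp
  | succ i ih =>
    intro R
    rw [iteratedDeriv_succ']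
    have : deriv (fun y => R.eval y) = fun y => R.derivative.eval y := by
      ext y; exact Polynomial.deriv R
    rw [this, ih]; rfl

lemma aux_poly_bound (i : ℕ) (R : Polynomial ℝ) :
    ∃ C, 0 ≤ C ∧ ∀ y, |(Polynomial.derivative^[i] R).eval y| ≤ C * (1 + |R.eval y|) := by
  set S := Polynomial.derivative^[i] R with hS
  have hdeg : S.degree ≤ R.degree := by
    rw [hS]; clear hS S
    induction i with
    | zero => simp
    | succ i ih =>
      rw [Function.iterate_succ_apply']
      exact Polynomial.degree_derivative_le.trans ih
  obtain ⟨c, hc⟩ := (Polynomial.isBigO_cobounded_of_degree_le hdeg).bound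
  rw [Metric.cobounded_eq_cocompact, Filter.Eventually, Filter.mem_cocompact] at hc
  obtain ⟨K, hK, hKc⟩ := hc
  obtain ⟨B, hB⟩ := hK.exists_bound_of_continuousOn (f := fun y => S.eval y)
    S.continuous.continuousOn
  refine ⟨|c| + |B|, by positivity, fun y => ?_⟩
  have h1 := abs_nonneg (R.eval y)
  have h2 := abs_nonneg c
  have h3 := abs_nonneg B
  by_cases hy : y ∈ K
  · have := hB y hy
    rw [Real.norm_eq_abs] at this
    nlinarith [le_abs_self B]
  · have : ‖S.eval y‖ ≤ c * ‖R.eval y‖ := hKc hy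
    rw [Real.norm_eq_abs, Real.norm_eq_abs] at this
    nlinarith [le_abs_self c]

lemma aux_conv_int {g f : ℝ → ℝ} (hg : Continuous g) {M : ℝ} (hM : ∀ y, |g y| ≤ M)
    (hf : Integrable f) (y : ℝ) : Integrable (fun s => g (y - s) * f s) :=
  hf.bdd_mul (c := M) (by fun_prop : Continuous fun s => g (y - s)).aestronglyMeasurable
    (Filter.Eventually.of_forall fun s => hM _)

lemma aux_conv_bdd {g f : ℝ → ℝ} (hg : Continuous g) {M : ℝ} (hM : ∀ y, |g y| ≤ M)
    (hf : Integrable f) (y : ℝ) : |∫ s, g (y - s) * f s| ≤ ∫ s, M * |f s| := by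
  refine (abs_integral_le_integral_abs).trans ?_
  refine integral_mono (aux_conv_int hg hM hf y).abs (hf.abs.const_mul M) fun s => ?_
  simp only [abs_mul]
  exact mul_le_mul_of_nonneg_right (hM _) (abs_nonneg _)

lemma aux_conv_cont {g f : ℝ → ℝ} (hg : Continuous g) {M : ℝ} (hM : ∀ y, |g y| ≤ M)
    (hf : Integrable f) : Continuous (fun y => ∫ s, g (y - s) * f s) := by
  refine continuous_of_dominated (bound := fun s => M * |f s|)
    (fun y => (aux_conv_int hg hM hf y).aestronglyMeasurable) (fun y => ?_)
    (hf.abs.const_mul M) ?_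
  · refine Filter.Eventually.of_forall fun s => ?_
    rw [Real.norm_eq_abs, abs_mul]
    exact mul_le_mul_of_nonneg_right (hM _) (abs_nonneg _)
  · exact Filter.Eventually.of_forall fun s => by fun_prop

lemma aux_conv_deriv {g g' f : ℝ → ℝ} (hd : ∀ y, HasDerivAt g (g' y) y) (hg' : Continuous g')
    {M M' : ℝ} (hM : ∀ y, |g y| ≤ M) (hM' : ∀ y, |g' y| ≤ M')
    (hf : Integrable f) (y : ℝ) :
    HasDerivAt (fun y => ∫ s, g (y - s) * f s) (∫ s, g' (y - s) * f s) y := by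
  have hg : Continuous g := continuous_iff_continuousAt.2 fun y => (hd y).continuousAt
  refine (hasDerivAt_integral_of_dominated_loc_of_deriv_le (s := Set.univ)
    (bound := fun s => M' * |f s|) (F := fun y s => g (y - s) * f s)
    (F' := fun y s => g' (y - s) * f s) Filter.univ_mem
    (Filter.Eventually.of_forall fun z => (aux_conv_int hg hM hf z).aestronglyMeasurable)
    (aux_conv_int hg hM hf y) (aux_conv_int hg' hM' hf y).aestronglyMeasurable ?_
    (hf.abs.const_mul M') ?_).2
  · refine Filter.Eventually.of_forall fun s z _ => ?_
    rw [Real.norm_eq_abs, abs_mul]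
    exact mul_le_mul_of_nonneg_right (hM' _) (abs_nonneg _)
  · refine Filter.Eventually.of_forall fun s z _ => ?_
    exact ((hd (z - s)).comp_sub_const z s).mul_const (f s)

lemma aux_conv_parts {g g' f : ℝ → ℝ} (hd : ∀ y, HasDerivAt g (g' y) y) (hg' : Continuous g')
    {M M' : ℝ} (hM : ∀ y, |g y| ≤ M) (hM' : ∀ y, |g' y| ≤ M')
    (hf : Integrable f) (hfd : Differentiable ℝ f) (hf' : Integrable (deriv f)) (y : ℝ) :
    ∫ s, g' (y - s) * f s = ∫ s, g (y - s) * deriv f s := by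
  have hg : Continuous g := continuous_iff_continuousAt.2 fun y => (hd y).continuousAt
  have := integral_mul_deriv_eq_deriv_mul_of_integrable (u := fun s => g (y - s))
    (u' := fun s => - g' (y - s)) (v := f) (v' := deriv f)
    (fun x _ => (hd (y - x)).comp_const_sub y x) (fun x _ => (hfd x).hasDerivAt)
    (aux_conv_int hg hM hf' y)
    ((aux_conv_int hg' hM' hf y).neg.congr (Filter.Eventually.of_forall fun s => by simp))
    (aux_conv_int hg hM hf y)
  rw [this, ← integral_neg]
  simp

lemma aux_conv_smooth {g g' : ℝ → ℝ} (hd : ∀ y, HasDerivAt g (g' y) y) (hg' : Continuous g')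
    {M M' : ℝ} (hM : ∀ y, |g y| ≤ M) (hM' : ∀ y, |g' y| ≤ M') (n : ℕ) :
    ∀ f : ℝ → ℝ, ContDiff ℝ n f → (∀ k ≤ n, Integrable (iteratedDeriv k f)) →
      ContDiff ℝ (n + 1 : ℕ) (fun y => ∫ s, g (y - s) * f s) ∧
      ∀ k ≤ n + 1, ∃ C, 0 ≤ C ∧
        ∀ y, |iteratedDeriv k (fun y => ∫ s, g (y - s) * f s) y| ≤ C := by
  have hg : Continuous g := continuous_iff_continuousAt.2 fun y => (hd y).continuousAt
  induction n with
  | zero =>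
    intro f _ hi
    have hf : Integrable f := by simpa using hi 0 le_rfl
    have hD := aux_conv_deriv hd hg' hM hM' hf
    have hde : deriv (fun y => ∫ s, g (y - s) * f s) = fun y => ∫ s, g' (y - s) * f s :=
      funext fun y => (hD y).deriv
    constructor
    · simp only [zero_add, Nat.cast_one]
      rw [contDiff_one_iff_deriv, hde]
      exact ⟨fun y => (hD y).differentiableAt, aux_conv_cont hg' hM' hf⟩
    · intro k hk
      interval_cases k
      · refine ⟨_, (abs_nonneg _).trans (aux_conv_bdd hg hM hf 0), fun y => ?_⟩
        rw [iteratedDeriv_zero]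
        exact aux_conv_bdd hg hM hf y
      · refine ⟨_, (abs_nonneg _).trans (aux_conv_bdd hg' hM' hf 0), fun y => ?_⟩
        rw [iteratedDeriv_one, hde]
        exact aux_conv_bdd hg' hM' hf y
  | succ n ih =>
    intro f hfc hi
    have hf : Integrable f := by simpa using hi 0 (Nat.zero_le _)
    have hf' : Integrable (deriv f) := by simpa using hi 1 (by omega)
    have hcd : ContDiff ℝ n (deriv f) := by
      push_cast at hfc
      exact (contDiff_succ_iff_deriv.1 hfc).2.2
    have hfd : Differentiable ℝ f := by
      push_cast at hfc
      exact (contDiff_succ_iff_deriv.1 hfc).1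
    have hD := aux_conv_deriv hd hg' hM hM' hf
    have hde : deriv (fun y => ∫ s, g (y - s) * f s) = fun y => ∫ s, g (y - s) * deriv f s :=
      funext fun y => (hD y).deriv.trans (aux_conv_parts hd hg' hM hM' hf hfd hf' y)
    obtain ⟨h1, h2⟩ := ih (deriv f) hcd (fun k hk => by
      rw [← iteratedDeriv_succ']; exact hi (k+1) (by omega))
    constructor
    · rw [Nat.cast_add (n + 1) 1, Nat.cast_one, contDiff_succ_iff_deriv, hde]
      refine ⟨fun y => (hD y).differentiableAt, fun h => ?_, h1⟩
      exact absurd h (by simp [-Nat.cast_add])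
    · intro k hk
      rcases k with _ | k
      · refine ⟨_, (abs_nonneg _).trans (aux_conv_bdd hg hM hf 0), fun y => ?_⟩
        rw [iteratedDeriv_zero]
        exact aux_conv_bdd hg hM hf y
      · rw [iteratedDeriv_succ', hde]
        exact h2 k (by omega)

lemma aux_poly_int {p : ℝ → ℝ} (hmom : ∀ k : ℕ, Integrable (fun y => y ^ k * p y))
    (R : Polynomial ℝ) : Integrable (fun y => R.eval y * p y) := by
  have : (fun y => R.eval y * p y)
      = fun y => ∑ i ∈ Finset.range (R.natDegree + 1), R.coeff i * (y ^ i * p y) := by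
    ext y
    rw [Polynomial.eval_eq_sum_range, Finset.sum_mul]
    exact Finset.sum_congr rfl fun i _ => by ring
  rw [this]
  exact integrable_finsetSum _ fun i _ => (hmom i).const_mul _

lemma aux_core (Q : Polynomial ℝ) {g g' p : ℝ → ℝ} (hd : ∀ y, HasDerivAt g (g' y) y)
    (hg' : Continuous g') {M M' : ℝ} (hM : ∀ y, |g y| ≤ M) (hM' : ∀ y, |g' y| ≤ M')
    (hmom : ∀ k : ℕ, Integrable (fun y => y ^ k * p y)) {A : ℝ} (hA : A ≠ 0)
    (hp : ∀ y, p y = A * Real.exp (-(Q.eval y + ∫ s, g (y - s) * p s))) (n : ℕ) :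
    ContDiff ℝ n p ∧ ∀ k ≤ n, ∃ C, 0 ≤ C ∧ ∀ y : ℝ, |iteratedDeriv k p y|
      ≤ C * (1 + |Q.derivative.eval y|) ^ k * Real.exp (-Q.eval y) := by
  have hg : Continuous g := continuous_iff_continuousAt.2 fun y => (hd y).continuousAt
  have hpi : Integrable p := by simpa using hmom 0
  set B : ℝ → ℝ := fun y => ∫ s, g (y - s) * p s with hB
  set N : ℝ := ∫ s, M * |p s|
  have hBb : ∀ y, |B y| ≤ N := aux_conv_bdd hg hM hpi
  have hpe : p = fun y => A * Real.exp (-(Q.eval y + B y)) := funext hp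
  have hQc : ∀ (m : ℕ) (R : Polynomial ℝ), ContDiff ℝ m (fun y => R.eval y) := fun m R => by
    have h := R.contDiff_aeval (𝕜 := ℝ) m
    simp only [Polynomial.coe_aeval_eq_eval] at h
    exact h
  have hexp : ∀ y, Real.exp (-Q.eval y) ≤ |A|⁻¹ * Real.exp N * |p y| := by
    intro y
    have hA' : 0 < |A| := abs_pos.2 hA
    rw [hp y, abs_mul, abs_of_pos (Real.exp_pos _)]
    have : |A|⁻¹ * Real.exp N * (|A| * Real.exp (-(Q.eval y + B y)))
        = Real.exp (N - (Q.eval y + B y)) := by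
      rw [sub_eq_add_neg, Real.exp_add]
      field_simp
    rw [this]
    apply Real.exp_le_exp.2
    linarith [(abs_le.1 (hBb y)).2]
  have hint : ∀ k : ℕ, Integrable
      (fun y => (1 + |Q.derivative.eval y|) ^ k * Real.exp (-Q.eval y)) := by
    intro k
    have h1 := (aux_poly_int hmom ((2 + Q.derivative ^ 2) ^ k)).abs.const_mul (|A|⁻¹ * Real.exp N)
    refine h1.mono' ?_ (Filter.Eventually.of_forall fun y => ?_)
    · have c1 := Q.continuous
      have c2 := Q.derivative.continuous
      exact (by fun_prop : Continuous (fun y => (1 + |Q.derivative.eval y|) ^ k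
        * Real.exp (-Q.eval y))).aestronglyMeasurable
    · rw [Real.norm_eq_abs, abs_of_nonneg (by positivity), abs_mul]
      have e1 : (1 + |Q.derivative.eval y|) ^ k ≤ |((2 + Q.derivative ^ 2) ^ k).eval y| := by
        simp only [Polynomial.eval_pow, Polynomial.eval_add, Polynomial.eval_ofNat, abs_pow]
        refine pow_le_pow_left₀ (by positivity) ?_ k
        refine le_trans ?_ (le_abs_self _)
        nlinarith [sq_abs (Q.derivative.eval y), sq_nonneg (|Q.derivative.eval y| - 1)]
      calc _ ≤ |((2 + Q.derivative ^ 2) ^ k).eval y| * (|A|⁻¹ * Real.exp N * |p y|) :=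
            mul_le_mul e1 (hexp y) (Real.exp_pos _).le (abs_nonneg _)
        _ = _ := by ring
  have hInt : ∀ k : ℕ, Continuous (iteratedDeriv k p) → (∃ C, 0 ≤ C ∧ ∀ y : ℝ,
      |iteratedDeriv k p y| ≤ C * (1 + |Q.derivative.eval y|) ^ k * Real.exp (-Q.eval y)) →
      Integrable (iteratedDeriv k p) := by
    rintro k hk ⟨C, hC0, hC⟩
    refine ((hint k).const_mul C).mono' hk.aestronglyMeasurable
      (Filter.Eventually.of_forall fun y => ?_)
    rw [Real.norm_eq_abs, ← mul_assoc]
    exact hC y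
  induction n with
  | zero =>
    constructor
    · have hBc : Continuous B := aux_conv_cont hg hM hpi
      have c1 := Q.continuous
      rw [Nat.cast_zero, contDiff_zero, hpe]
      fun_prop
    · intro k hk
      obtain rfl : k = 0 := by omega
      refine ⟨|A| * Real.exp N, by positivity, fun y => ?_⟩
      rw [iteratedDeriv_zero, hp y, abs_mul, abs_of_pos (Real.exp_pos _), pow_zero, mul_one,
        mul_assoc, ← Real.exp_add]
      refine mul_le_mul_of_nonneg_left (Real.exp_le_exp.2 ?_) (abs_nonneg _)
      linarith [(abs_le.1 (hBb y)).1]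
  | succ n ih =>
    obtain ⟨ih1, ih2⟩ := ih
    obtain ⟨hBs, hBd⟩ := aux_conv_smooth hd hg' hM hM' n p ih1 fun k hk =>
      hInt k (ih1.continuous_iteratedDeriv k (by exact_mod_cast hk)) (ih2 k hk)
    change ContDiff ℝ (n + 1 : ℕ) B at hBs
    have hps : ContDiff ℝ (n + 1 : ℕ) p := by
      rw [hpe]
      exact contDiff_const.mul (((hQc _ Q).add hBs).neg.exp)
    refine ⟨hps, fun k hk => ?_⟩
    rcases Nat.lt_or_ge k (n + 1) with hk' | hk'
    · exact ih2 k (by omega)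
    obtain rfl : k = n + 1 := by omega
    have hBs' : Differentiable ℝ B ∧ ContDiff ℝ n (deriv B) := by
      have := hBs
      push_cast at this
      exact ⟨(contDiff_succ_iff_deriv.1 this).1, (contDiff_succ_iff_deriv.1 this).2.2⟩
    set W : ℝ → ℝ := fun y => Q.derivative.eval y + deriv B y with hW
    have hWc : ContDiff ℝ n W := (hQc n _).add hBs'.2
    have hdp : deriv p = fun y => -(W y * p y) := by
      ext y
      have h1 : HasDerivAt (fun y => Q.eval y + B y) (W y) y :=
        (Q.hasDerivAt y).add (hBs'.1 y).hasDerivAt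
      have h2 := (h1.neg.exp.const_mul A).deriv
      have h3 : deriv p y = A * (Real.exp (-(Q.eval y + B y)) * -W y) := by
        refine Eq.trans ?_ h2
        conv_lhs => rw [hpe]
        rfl
      rw [h3, hp y]; ring
    have hWb : ∀ i ≤ n, ∃ C, 0 ≤ C ∧ ∀ y,
        |iteratedDeriv i W y| ≤ C * (1 + |Q.derivative.eval y|) := by
      intro i hi
      obtain ⟨C1, hC1, h1⟩ := aux_poly_bound i Q.derivative
      obtain ⟨C2, hC2, h2⟩ := hBd (i + 1) (by omega)
      refine ⟨C1 + C2, by positivity, fun y => ?_⟩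
      have hi' : ((i : ℕ) : WithTop ℕ∞) ≤ n := by exact_mod_cast hi
      rw [hW, iteratedDeriv_fun_add (hQc i _).contDiffAt (hBs'.2.of_le hi').contDiffAt,
        aux_poly_iter]
      have h2' := h2 y
      rw [iteratedDeriv_succ'] at h2'
      change |iteratedDeriv i (deriv B) y| ≤ C2 at h2'
      refine (abs_add_le _ _).trans ?_
      have := h1 y
      nlinarith [mul_nonneg hC2 (abs_nonneg (Q.derivative.eval y))]
    choose! CW hCW0 hCW using hWb
    choose! CP hCP0 hCP using ih2
    refine ⟨∑ i ∈ Finset.range (n + 1), (n.choose i : ℝ) * CW i * CP (n - i), ?_, fun y => ?_⟩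
    · refine Finset.sum_nonneg fun i hi => ?_
      rw [Finset.mem_range] at hi
      have := hCW0 i (by omega)
      have := hCP0 (n - i) (by omega)
      positivity
    rw [iteratedDeriv_succ', hdp, iteratedDeriv_fun_neg, abs_neg,
      iteratedDeriv_fun_mul hWc.contDiffAt ih1.contDiffAt]
    refine (Finset.abs_sum_le_sum_abs _ _).trans ?_
    rw [Finset.sum_mul, Finset.sum_mul]
    refine Finset.sum_le_sum fun i hi => ?_
    rw [Finset.mem_range] at hi
    have w0 := hCW0 i (by omega)
    have p0 := hCP0 (n - i) (by omega)
    have w1 := hCW i (by omega) y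
    have p1 := hCP (n - i) (by omega) y
    set t := 1 + |Q.derivative.eval y| with ht
    have ht1 : 1 ≤ t := by linarith [abs_nonneg (Q.derivative.eval y)]
    rw [abs_mul, abs_mul, Nat.abs_cast]
    calc (n.choose i : ℝ) * |iteratedDeriv i W y| * |iteratedDeriv (n - i) p y|
        ≤ (n.choose i : ℝ) * (CW i * t) * (CP (n - i) * t ^ (n - i) * Real.exp (-Q.eval y)) := by
          gcongr
      _ = (n.choose i : ℝ) * CW i * CP (n - i) * t ^ (n - i + 1) * Real.exp (-Q.eval y) := by
          ring
      _ ≤ _ := by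
          gcongr <;> first | exact ht1 | omega

lemma aux_even_sum (F : ℕ → ℝ) (hF : ∀ i, F (2 * i + 1) = 0) (k : ℕ) :
    ∑ i ∈ Finset.range (2 * k + 1), F i = ∑ j ∈ Finset.range (k + 1), F (2 * j) := by
  induction k with
  | zero => simp
  | succ k ih =>
    rw [show 2 * (k + 1) + 1 = 2 * k + 1 + 1 + 1 by ring, Finset.sum_range_succ,
      Finset.sum_range_succ, ih, hF, Finset.sum_range_succ _ (k + 1)]
    simp [mul_add]

lemma aux_moment {p : ℝ → ℝ} (hpeven : ∀ y, p (-y) = p y)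
    (hmom : ∀ k : ℕ, Integrable (fun y => y ^ k * p y)) (k : ℕ) (y : ℝ) :
    Integrable (fun s => (y - s) ^ (2 * k) * p s) ∧
    ∫ s, (y - s) ^ (2 * k) * p s = ∑ j ∈ Finset.range (k + 1),
      (Nat.choose (2 * k) (2 * j) : ℝ) * y ^ (2 * j) * ∫ s, s ^ (2 * (k - j)) * p s := by
  have hexpand : ∀ s, (y - s) ^ (2 * k) * p s = ∑ i ∈ Finset.range (2 * k + 1),
      ((Nat.choose (2 * k) i : ℝ) * y ^ i * (-1) ^ (2 * k - i)) * (s ^ (2 * k - i) * p s) := by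
    intro s
    rw [sub_eq_add_neg, add_pow, Finset.sum_mul]
    refine Finset.sum_congr rfl fun i _ => ?_
    rw [neg_pow s]; ring
  have hodd : ∀ r : ℕ, Odd r → ∫ s, s ^ r * p s = 0 := by
    intro r hr
    have h := integral_neg_eq_self (fun s => s ^ r * p s) volume
    simp only [hpeven, hr.neg_pow, neg_mul] at h
    rw [integral_neg] at h
    linarith
  simp_rw [hexpand]
  constructor
  · exact integrable_finsetSum _ fun i _ => (hmom _).const_mul _
  · rw [integral_finsetSum _ fun i _ => (hmom _).const_mul _]
    simp_rw [integral_const_mul]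
    -- replace by a function with vanishing odd terms
    have : ∀ i ∈ Finset.range (2 * k + 1),
        ((Nat.choose (2 * k) i : ℝ) * y ^ i * (-1) ^ (2 * k - i)) * ∫ s, s ^ (2 * k - i) * p s
        = if Even i then (Nat.choose (2 * k) i : ℝ) * y ^ i * ∫ s, s ^ (2 * k - i) * p s
          else 0 := by
      intro i hi
      rw [Finset.mem_range] at hi
      split_ifs with he
      · have : Even (2 * k - i) := by
          rw [Nat.even_sub (by omega)]; simp [he]
        rw [this.neg_one_pow, mul_one]
      · have : Odd (2 * k - i) := by
          rw [← Nat.not_even_iff_odd, Nat.even_sub (by omega)]; simp [he]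
        rw [hodd _ this, mul_zero]
    rw [Finset.sum_congr rfl this, aux_even_sum _ (fun i => by simp)]
    refine Finset.sum_congr rfl fun j _ => ?_
    simp [Nat.mul_sub]

theorem invariant_density_smooth_with_derivative_bounds
    (J₁ J : ℕ) (hJ₁ : 1 ≤ J₁) (hJ : J₁ ≤ J)
    (θ : ℕ → ℝ) (hθpos : ∀ j ∈ Finset.Icc (J₁+1) J, 0 < θ j)
    (hθdist : ∀ i ∈ Finset.Icc (J₁+1) J, ∀ j ∈ Finset.Icc (J₁+1) J, i ≠ j → θ i ≠ θ j)
    (a : ℕ → ℝ)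
    (β β' β'' : ℝ → ℝ)
    (hβd : ∀ y, HasDerivAt β (β' y) y)
    (hβd2 : ∀ y, HasDerivAt β' (β'' y) y)
    (hβ''cont : Continuous β'')
    (hβeven : ∀ y, β (-y) = β y)
    (hβbd : ∃ C, ∀ y, |β y| ≤ C) (hβ'bd : ∃ C, ∀ y, |β' y| ≤ C)
    (hβ''bd : ∃ C, ∀ y, |β'' y| ≤ C)
    (hβ'L1 : Integrable β')
    (φ : ℝ → ℝ)
    (hφ : ∀ y, φ y = (∑ j ∈ Finset.Icc 1 J₁, a j * y ^ (2*j))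
        + (∑ j ∈ Finset.Icc (J₁+1) J, a j * Real.cos (θ j * y)) + β y)
    (p : ℝ → ℝ) (hpmeas : Measurable p) (hpnonneg : ∀ y, 0 ≤ p y)
    (hpint : ∫ y, p y = 1) (hpeven : ∀ y, p (-y) = p y)
    (hmom : ∀ k : ℕ, Integrable (fun y => y ^ k * p y))
    (Z : ℝ) (hZ : Z = ∫ x, Real.exp (-∫ s, φ (x - s) * p s))
    (hfix : ∀ y, p y = Z⁻¹ * Real.exp (-∫ s, φ (y - s) * p s))
    (m : ℕ → ℝ) (hm : ∀ k, m k = ∫ y, y ^ k * p y)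
    (α : ℕ → ℝ)
    (hα₁ : ∀ j ∈ Finset.Icc 1 J₁,
      α j = ∑ k ∈ Finset.Icc j J₁, (Nat.choose (2*k) (2*j) : ℝ) * m (2*(k-j)) * a k) :
    ContDiff ℝ (⊤ : ℕ∞) p ∧
      ∀ n : ℕ, ∃ C > 0, ∀ y : ℝ,
        |iteratedDeriv n p y|
          ≤ C * (1 + |∑ j ∈ Finset.Icc 1 J₁, α j * (2 * j) * y ^ (2 * j - 1)|) ^ n
              * Real.exp (-∑ j ∈ Finset.Icc 1 J₁, α j * y ^ (2 * j)) := by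
  obtain ⟨Mβ, hMβ⟩ := hβbd
  obtain ⟨Mβ', hMβ'⟩ := hβ'bd
  have hβ'c : Continuous β' := continuous_iff_continuousAt.2 fun y => (hβd2 y).continuousAt
  have hpi : Integrable p := by simpa using hmom 0
  set g : ℝ → ℝ := fun y => (∑ j ∈ Finset.Icc (J₁+1) J, a j * Real.cos (θ j * y)) + β y with hgdef
  set g' : ℝ → ℝ := fun y =>
    (∑ j ∈ Finset.Icc (J₁+1) J, a j * (-Real.sin (θ j * y) * θ j)) + β' y with hg'def
  have hd : ∀ y, HasDerivAt g (g' y) y := by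
    intro y
    refine HasDerivAt.add (HasDerivAt.fun_sum fun j _ => ?_) (hβd y)
    have h1 : HasDerivAt (fun y : ℝ => θ j * y) (θ j) y := by
      simpa using (hasDerivAt_id y).const_mul (θ j)
    exact (h1.cos).const_mul (a j)
  have hg : Continuous g := continuous_iff_continuousAt.2 fun y => (hd y).continuousAt
  have hg' : Continuous g' := by fun_prop
  have hM : ∀ y, |g y| ≤ (∑ j ∈ Finset.Icc (J₁+1) J, |a j|) + Mβ := by
    intro y
    refine (abs_add_le _ _).trans (add_le_add ((Finset.abs_sum_le_sum_abs _ _).trans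
      (Finset.sum_le_sum fun j _ => ?_)) (hMβ y))
    rw [abs_mul]
    exact mul_le_of_le_one_right (abs_nonneg _) (Real.abs_cos_le_one _)
  have hM' : ∀ y, |g' y| ≤ (∑ j ∈ Finset.Icc (J₁+1) J, |a j| * |θ j|) + Mβ' := by
    intro y
    refine (abs_add_le _ _).trans (add_le_add ((Finset.abs_sum_le_sum_abs _ _).trans
      (Finset.sum_le_sum fun j _ => ?_)) (hMβ' y))
    rw [abs_mul, abs_mul, abs_neg]
    exact mul_le_mul_of_nonneg_left
      (mul_le_of_le_one_left (abs_nonneg _) (Real.abs_sin_le_one _)) (abs_nonneg _)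
  set Q : Polynomial ℝ :=
    ∑ j ∈ Finset.Icc 1 J₁, Polynomial.C (α j) * Polynomial.X ^ (2 * j) with hQ
  have hQe : ∀ y, Q.eval y = ∑ j ∈ Finset.Icc 1 J₁, α j * y ^ (2 * j) := by
    intro y; simp [hQ, Polynomial.eval_finsetSum]
  have hQd : ∀ y, Q.derivative.eval y
      = ∑ j ∈ Finset.Icc 1 J₁, α j * (2 * j) * y ^ (2 * j - 1) := by
    intro y
    simp only [hQ, Polynomial.derivative_sum, Polynomial.eval_finsetSum,
      Polynomial.derivative_C_mul_X_pow]
    simp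
  set c : ℝ := ∑ k ∈ Finset.Icc 1 J₁, a k * m (2 * k) with hc
  have hV : ∀ y, ∫ s, φ (y - s) * p s = c + (Q.eval y + ∫ s, g (y - s) * p s) := by
    intro y
    have e1 : ∀ s, φ (y - s) * p s = (∑ k ∈ Finset.Icc 1 J₁, a k * ((y - s) ^ (2 * k) * p s))
        + g (y - s) * p s := by
      intro s
      rw [hφ, hgdef, add_assoc, add_mul, Finset.sum_mul]
      simp only [mul_assoc]
    simp_rw [e1]
    rw [integral_add (integrable_finsetSum _ fun k _ =>
      ((aux_moment hpeven hmom k y).1).const_mul _) (aux_conv_int hg hM hpi y),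
      integral_finsetSum _ fun k _ => ((aux_moment hpeven hmom k y).1).const_mul _,
      ← add_assoc]
    congr 1
    simp_rw [integral_const_mul, (aux_moment hpeven hmom _ y).2, ← hm]
    have e2 : ∀ k, a k * ∑ j ∈ Finset.range (k + 1),
        (Nat.choose (2 * k) (2 * j) : ℝ) * y ^ (2 * j) * m (2 * (k - j))
        = a k * m (2 * k) + ∑ j ∈ Finset.Icc 1 k,
          (Nat.choose (2 * k) (2 * j) : ℝ) * m (2 * (k - j)) * a k * y ^ (2 * j) := by
      intro k
      rw [Finset.range_eq_Ico, Finset.sum_eq_sum_Ico_succ_bot (Nat.succ_pos k), mul_add,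
        Finset.mul_sum]
      have : Finset.Ico (0 + 1) (k + 1) = Finset.Icc 1 k := by
        ext x; simp only [Finset.mem_Ico, Finset.mem_Icc]; omega
      rw [this]
      congr 1
      · simp
      · exact Finset.sum_congr rfl fun j _ => by ring
    simp_rw [e2]
    rw [Finset.sum_add_distrib, hQe, hc]
    congr 1
    rw [Finset.sum_comm' (t' := Finset.Icc 1 J₁) (s' := fun j => Finset.Icc j J₁)
      (by intro x z; simp only [Finset.mem_Icc]; omega)]
    refine Finset.sum_congr rfl fun j hj => ?_
    rw [hα₁ j hj, Finset.sum_mul]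
  have hp : ∀ y, p y = (Z⁻¹ * Real.exp (-c))
      * Real.exp (-(Q.eval y + ∫ s, g (y - s) * p s)) := by
    intro y
    rw [mul_assoc, ← Real.exp_add, ← neg_add, ← hV, ← hfix]
  have hA : Z⁻¹ * Real.exp (-c) ≠ 0 := by
    intro h
    have : p = fun _ => 0 := by
      ext y; rw [hp y, h, zero_mul]
    rw [this] at hpint
    simp at hpint
  have key := aux_core Q hd hg' hM hM' hmom hA hp
  refine ⟨contDiff_infty.2 fun n => (key n).1, fun n => ?_⟩
  obtain ⟨C, hC0, hC⟩ := (key n).2 n le_rfl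
  refine ⟨C + 1, by positivity, fun y => ?_⟩
  rw [← hQe, ← hQd]
  refine (hC y).trans ?_
  gcongr
  linarith
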